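/- Let k be a positive integer and let G be a k-connected finite simple graph with n > k vertices and maximum degree Δ ≥ 2. Then F_k(G) ≤ ((Δ - 2)·n + 2) / (Δ + k - 2). -/

import Mathlib

open Finset SimpleGraph

/-- One round of the `k`-forcing color change rule: to the currently colored set `C` we add
every vertex `w` having a colored neighbor `v` with at most `k` non-colored neighbors. -/
def kForceStep {V : Type*} [Fintype V] [DecidableEq V] (G : SimpleGraph V)
    [DecidableRel G.Adj] (k : ℕ) (C : Finset V) : Finset V :=
  C ∪ Finset.univ.filter (fun w =>
    ∃ v ∈ C, G.Adj v w ∧ ((G.neighborFinset v) \ C).card ≤ k)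

/-- `S` is a `k`-forcing set: iterating the color change rule starting from `S`
eventually colors all vertices. -/
def IsKForcingSet {V : Type*} [Fintype V] [DecidableEq V] (G : SimpleGraph V)
    [DecidableRel G.Adj] (k : ℕ) (S : Finset V) : Prop :=
  (kForceStep G k)^[Fintype.card V] S = Finset.univ

/-- The `k`-forcing number: the minimum cardinality of a `k`-forcing set. -/
noncomputable def kForcingNumber {V : Type*} [Fintype V] [DecidableEq V] (G : SimpleGraph V)
    [DecidableRel G.Adj] (k : ℕ) : ℕ :=
  sInf {m | ∃ S : Finset V, IsKForcingSet G k S ∧ S.card = m}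

/-- `G` is `k`-connected: it has more than `k` vertices and the removal of any set of fewer
than `k` vertices results in a connected (induced) subgraph. -/
def KConnected {V : Type*} [Fintype V] [DecidableEq V] (G : SimpleGraph V) (k : ℕ) : Prop :=
  k < Fintype.card V ∧
    ∀ A : Finset V, A.card < k → (G.induce ((A : Set V)ᶜ)).Connected

/-- `D` is a connected `k`-dominating set: every vertex not in `D` has at least `k` neighbors
in `D`, and the subgraph induced by `D` is connected. -/
def IsConnKDomSet {V : Type*} [Fintype V] [DecidableEq V] (G : SimpleGraph V)
    [DecidableRel G.Adj] (k : ℕ) (D : Finset V) : Prop :=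
  (∀ v : V, v ∉ D → k ≤ ((G.neighborFinset v) ∩ D).card) ∧
    (G.induce (D : Set V)).Connected

/-- The connected `k`-domination number: the minimum cardinality of a connected
`k`-dominating set. -/
noncomputable def connKDomNumber {V : Type*} [Fintype V] [DecidableEq V] (G : SimpleGraph V)
    [DecidableRel G.Adj] (k : ℕ) : ℕ :=
  sInf {m | ∃ D : Finset V, IsConnKDomSet G k D ∧ D.card = m}

section

variable {V : Type*} [Fintype V] [DecidableEq V] {G : SimpleGraph V} {k : ℕ}

lemma KConnected.exists_adj_boundary (h : KConnected G k) {A : Finset V} (hA : A.card < k)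
    (C : Set V) {v w : V} (hv : v ∈ C) (hw : w ∉ C) (hvA : v ∉ A) (hwA : w ∉ A) :
    ∃ x y, x ∈ C ∧ y ∉ C ∧ y ∉ A ∧ G.Adj x y := by
  obtain ⟨p⟩ := (h.2 A hA).preconnected ⟨v, by simpa using hvA⟩ ⟨w, by simpa using hwA⟩
  obtain ⟨d, -, h1, h2⟩ := p.exists_boundary_dart {x | x.1 ∈ C} hv hw
  exact ⟨d.fst.1, d.snd.1, h1, h2, fun hA => d.snd.2 hA, d.adj⟩

variable [DecidableRel G.Adj]

lemma subset_kForceStep (C : Finset V) : C ⊆ kForceStep G k C :=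
  subset_union_left

lemma kForceStep_mono : Monotone (kForceStep G k) := by
  intro C D h w hw
  simp only [kForceStep, mem_union, mem_filter, mem_univ, true_and] at hw ⊢
  rcases hw with hw | ⟨v, hv, hvw, hc⟩
  · exact Or.inl (h hw)
  · exact Or.inr ⟨v, h hv, hvw, (card_le_card (sdiff_subset_sdiff subset_rfl h)).trans hc⟩

/-- If `C` is colored within `j` rounds and `v ∈ C`, then adding to the initial set all but `k`
of the neighbors of `v` outside `C` colors all neighbors of `v` in one more round. -/
lemma exists_kForceStep_extension {S C : Finset V} {j : ℕ}
    (h : C ⊆ (kForceStep G k)^[j] S) {v : V} (hv : v ∈ C) :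
    ∃ S' : Finset V, S'.card ≤ S.card + ((G.neighborFinset v \ C).card - k) ∧
      C ∪ (G.neighborFinset v \ C) ⊆ (kForceStep G k)^[j + 1] S' := by
  obtain ⟨T, hTU, hT⟩ := exists_subset_card_eq
    (Nat.sub_le (G.neighborFinset v \ C).card k)
  refine ⟨S ∪ T, (card_union_le _ _).trans (by rw [hT]), ?_⟩
  have hCT : C ∪ T ⊆ (kForceStep G k)^[j] (S ∪ T) := by
    apply union_subset
    · exact h.trans (kForceStep_mono.iterate j subset_union_left)
    · exact subset_union_right.trans
        (Function.id_le_iterate_of_id_le (f := kForceStep G k) subset_kForceStep j (S ∪ T))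
  rw [Function.iterate_succ_apply']
  refine Subset.trans ?_ (kForceStep_mono hCT)
  intro w hw
  rcases mem_union.1 hw with hw | hw
  · exact subset_kForceStep _ (mem_union_left _ hw)
  · refine mem_union_right _ (mem_filter.2 ⟨mem_univ _, v, mem_union_left _ hv, ?_, ?_⟩)
    · simpa using (mem_sdiff.1 hw).1
    · have hU : G.neighborFinset v \ (C ∪ T) = (G.neighborFinset v \ C) \ T := by
        ext x
        simp only [mem_sdiff, mem_union]
        tauto
      rw [hU, card_sdiff_of_subset hTU, hT]
      omega

lemma KConnected.le_degree (h : KConnected G k) (v : V) : k ≤ G.degree v := by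
  by_contra! hlt
  have hcard : (insert v (G.neighborFinset v)).card < Fintype.card V := by
    have := card_insert_le v (G.neighborFinset v)
    rw [card_neighborFinset_eq_degree] at this
    have := h.1
    omega
  obtain ⟨w, hw⟩ : ∃ w, w ∉ insert v (G.neighborFinset v) := by
    by_contra! hall
    rw [eq_univ_of_forall hall, card_univ] at hcard
    exact lt_irrefl _ hcard
  rw [mem_insert, not_or] at hw
  obtain ⟨x, y, hx, -, hyA, hxy⟩ := h.exists_adj_boundary (A := G.neighborFinset v)
    (by rwa [card_neighborFinset_eq_degree]) {v} rfl hw.1 (by simp) hw.2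
  rw [Set.mem_singleton_iff] at hx
  subst hx
  exact hyA (by simpa using hxy)

/-- Greedy construction: a set `S` which colors, within `C.card` rounds, a set `C` with
at least `i` vertices. -/
lemma KConnected.exists_partial_kForcing (hk : 1 ≤ k) (h : KConnected G k) {d : ℕ}
    (hd : G.maxDegree = d + 2) (i : ℕ) (hi : i ≤ Fintype.card V) :
    ∃ (S C : Finset V) (j : ℕ), i ≤ C.card ∧ j ≤ C.card ∧ C ⊆ (kForceStep G k)^[j] S ∧
      C.Nonempty ∧ (∀ x ∈ C, ∃ y ∈ C, G.Adj x y) ∧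
      S.card * (d + k) ≤ d * C.card + 2 := by
  induction i with
  | zero =>
    have : Nonempty V := Fintype.card_pos_iff.1 (by have := h.1; omega)
    obtain ⟨v, hv⟩ := G.exists_maximal_degree_vertex
    obtain ⟨S, hS, hC⟩ := exists_kForceStep_extension (G := G) (k := k) (j := 0)
      (Subset.refl {v}) (mem_singleton_self v)
    have hU : G.neighborFinset v \ {v} = G.neighborFinset v := by simp
    rw [hU] at hS hC
    have hkd := h.le_degree v
    rw [← hv, hd] at hkd
    rw [card_singleton, card_neighborFinset_eq_degree, ← hv, hd] at hS
    have hcard : ({v} ∪ G.neighborFinset v).card = d + 3 := by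
      rw [card_union_of_disjoint (by simp), card_neighborFinset_eq_degree, ← hv, hd,
        card_singleton]
      omega
    refine ⟨S, _, 1, Nat.zero_le _, by omega, hC, ⟨v, by simp⟩, ?_, ?_⟩
    · intro x hx
      rcases mem_union.1 hx with hx | hx
      · rw [mem_singleton] at hx
        subst hx
        obtain ⟨y, hy⟩ : (G.neighborFinset x).Nonempty := by
          rw [← card_pos, card_neighborFinset_eq_degree]
          omega
        exact ⟨y, mem_union_right _ hy, by simpa using hy⟩
      · exact ⟨v, by simp, by simpa [G.adj_comm] using hx⟩
    · rw [hcard]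
      obtain ⟨t, ht⟩ := Nat.exists_eq_add_of_le hkd
      obtain ⟨l, rfl⟩ := Nat.exists_eq_add_of_le hk
      have hS' : S.card ≤ 1 + t := by omega
      refine (Nat.mul_le_mul_right _ hS').trans ?_
      have hl : l ≤ l * l := Nat.le_mul_self l
      have hdl : d + 1 = l + t := by omega
      zify at hdl hl ⊢
      have ht' : (t : ℤ) = d + 1 - l := by linarith
      rw [ht']
      nlinarith
  | succ i ih =>
    obtain ⟨S, C, j, hiC, hj, hSC, hne, hnb, hle⟩ := ih (by omega)
    by_cases hlt : i + 1 ≤ C.card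
    · exact ⟨S, C, j, hlt, hj, hSC, hne, hnb, hle⟩
    obtain ⟨w, hw⟩ : ∃ w, w ∉ C := by
      by_contra! hall
      rw [eq_univ_of_forall hall, card_univ] at hlt
      exact hlt hi
    obtain ⟨u, hu⟩ := hne
    obtain ⟨v, y, hv, hy, -, hvy⟩ := h.exists_adj_boundary (A := ∅) (by rw [card_empty]; omega)
      (C : Set V) hu hw (by simp) (by simp)
    rw [mem_coe] at hv hy
    obtain ⟨S', hS', hC'⟩ := exists_kForceStep_extension hSC hv
    have hcard : (C ∪ (G.neighborFinset v \ C)).card =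
        C.card + (G.neighborFinset v \ C).card := card_union_of_disjoint disjoint_sdiff
    have hpos : 0 < (G.neighborFinset v \ C).card :=
      card_pos.2 ⟨y, by simp [hvy, hy]⟩
    have hub : (G.neighborFinset v \ C).card < d + 2 := by
      rw [← hd]
      refine lt_of_lt_of_le ?_ (G.degree_le_maxDegree v)
      rw [← card_neighborFinset_eq_degree]
      obtain ⟨z, hz, hvz⟩ := hnb v hv
      refine card_lt_card ⟨sdiff_subset, fun hsub => ?_⟩
      exact (mem_sdiff.1 (hsub ((G.mem_neighborFinset v z).2 hvz))).2 hz
    refine ⟨S', _, j + 1, by omega, by omega, hC', ⟨u, mem_union_left _ hu⟩, ?_, ?_⟩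
    · intro x hx
      rcases mem_union.1 hx with hx | hx
      · obtain ⟨z, hz, hxz⟩ := hnb x hx
        exact ⟨z, mem_union_left _ hz, hxz⟩
      · refine ⟨v, mem_union_left _ hv, ?_⟩
        simpa [G.adj_comm] using (mem_sdiff.1 hx).1
    · rw [hcard]
      generalize (G.neighborFinset v \ C).card = m at *
      refine (Nat.mul_le_mul_right _ hS').trans ?_
      suffices (m - k) * (d + k) ≤ d * m by linarith
      rcases Nat.le_total m k with hmk | hkm
      · simp [Nat.sub_eq_zero_of_le hmk]
      · obtain ⟨t, rfl⟩ := Nat.exists_eq_add_of_le hkm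
        have htd : t ≤ d := by omega
        rw [Nat.add_sub_cancel_left]
        nlinarith [Nat.mul_le_mul_right k htd]

end

/-- Theorem: If `G` is `k`-connected with `n > k` vertices and maximum
degree `Δ ≥ 2`, then `F_k(G) ≤ ((Δ - 2) n + 2) / (Δ + k - 2)`. -/
theorem kForcingNumber_le_of_kConnected {V : Type*} [Fintype V] [DecidableEq V]
    (G : SimpleGraph V) [DecidableRel G.Adj] (k : ℕ) (hk : 1 ≤ k)
    (hkconn : KConnected G k) (hn : k < Fintype.card V) (hΔ : 2 ≤ G.maxDegree) :
    (kForcingNumber G k : ℝ) ≤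
      (((G.maxDegree : ℝ) - 2) * (Fintype.card V) + 2) / ((G.maxDegree : ℝ) + k - 2) := by
  obtain ⟨d, hd⟩ := Nat.exists_eq_add_of_le' hΔ
  obtain ⟨S, C, j, hC, hj, hSC, -, -, hle⟩ :=
    hkconn.exists_partial_kForcing hk hd (Fintype.card V) le_rfl
  have hCu : C = univ := (card_eq_iff_eq_univ C).1 (le_antisymm (card_le_univ C) hC)
  subst hCu
  rw [card_univ] at hj hle
  have hS : IsKForcingSet G k S :=
    univ_subset_iff.1 (hSC.trans
      (Function.monotone_iterate_of_id_le (f := kForceStep G k) subset_kForceStep hj S))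
  have hF : kForcingNumber G k ≤ S.card := Nat.sInf_le ⟨S, hS, rfl⟩
  have hmul : kForcingNumber G k * (d + k) ≤ d * Fintype.card V + 2 :=
    (Nat.mul_le_mul_right _ hF).trans hle
  have hk' : (1 : ℝ) ≤ k := by exact_mod_cast hk
  have hd' : (0 : ℝ) ≤ d := d.cast_nonneg
  have hmul' : (kForcingNumber G k : ℝ) * (d + k) ≤ d * Fintype.card V + 2 := by
    exact_mod_cast hmul
  rw [hd, le_div_iff₀ (by push_cast; linarith)]
  push_cast
  linarith
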